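/- Let Z, Y be complex vector spaces, D ⊆ Z a subspace, G : D → Z a linear map, ω ∈ ℝ, n ≥ 1, and G₂ : Y → Z an injective linear map such that ran(iω − G) ∩ ran(G₂) = {0} and N_{n−1}(ω,G) ⊆ ran(iω − G). Suppose (z_n, …, z_1) ∈ D^n and (y_n, …, y_1) ∈ Y^n satisfy iω z_1 − G z_1 = G₂ y_1 and iω z_l − G z_l + z_{l−1} = G₂ y_l for l = 2, …, n. Then y_l = 0 for all l = 1, …, n, and consequently J_n(z_n, …, z_1) = 0. -/

import Mathlib

/-- The generalized kernels `N_l(ω, G)` of `iω − G`: `N_0 = {0}` and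
`N_{l+1} = {z ∈ D : iω z − G z ∈ N_l}`. -/
def genKer {Z : Type*} [AddCommGroup Z] [Module ℂ Z] {D : Submodule ℂ Z}
    (G : D →ₗ[ℂ] Z) (ω : ℝ) : ℕ → Set D
  | 0 => {0}
  | l + 1 => {z | ∃ w ∈ genKer G ω l, (Complex.I * ω) • (z : Z) - G z = (w : Z)}

theorem genKer_neg {Z : Type*} [AddCommGroup Z] [Module ℂ Z] {D : Submodule ℂ Z}
    (G : D →ₗ[ℂ] Z) (ω : ℝ) (l : ℕ) : ∀ z : D, z ∈ genKer G ω l → -z ∈ genKer G ω l := by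
  induction l with
  | zero =>
    intro z hz
    have hz0 : z = 0 := hz
    change -z = 0
    rw [hz0, neg_zero]
  | succ l ih =>
    rintro z ⟨w, hw, h⟩
    refine ⟨-w, ih w hw, ?_⟩
    rw [Submodule.coe_neg, Submodule.coe_neg, ← h, map_neg, smul_neg]
    abel

theorem genKer_succ {Z : Type*} [AddCommGroup Z] [Module ℂ Z] {D : Submodule ℂ Z}
    (G : D →ₗ[ℂ] Z) (ω : ℝ) (l : ℕ) : genKer G ω l ⊆ genKer G ω (l + 1) := by
  induction l with
  | zero =>
    intro z hz
    have hz0 : z = 0 := hz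
    refine ⟨0, rfl, ?_⟩
    rw [hz0]
    simp
  | succ l ih =>
    rintro z ⟨w, hw, h⟩
    exact ⟨w, ih hw, h⟩

theorem genKer_mono {Z : Type*} [AddCommGroup Z] [Module ℂ Z] {D : Submodule ℂ Z}
    (G : D →ₗ[ℂ] Z) (ω : ℝ) {l m : ℕ} (h : l ≤ m) : genKer G ω l ⊆ genKer G ω m :=
  monotone_nat_of_le_succ (f := genKer G ω) (genKer_succ G ω) h

/-- Triangular elimination under the G-conditions: if `G₂` is injective,
`ran(iω − G) ∩ ran G₂ = {0}` and `N_{n−1}(ω, G) ⊆ ran(iω − G)`, and if the tuples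
`(z_n, …, z_1)` and `(y_n, …, y_1)` satisfy `J_n z⃗ = 𝒢₂ y⃗` componentwise, then all `y_l`
vanish and `J_n z⃗ = 0`.  Tuples are indexed zero-based: `z l` is `z_{l+1}`, `y l` is
`y_{l+1}`. -/
theorem stmt_8 {Z Y : Type*} [AddCommGroup Z] [Module ℂ Z] [AddCommGroup Y] [Module ℂ Y]
    (D : Submodule ℂ Z) (G : D →ₗ[ℂ] Z) (ω : ℝ) (n : ℕ) (hn : 1 ≤ n)
    (G₂ : Y →ₗ[ℂ] Z) (hG₂ : Function.Injective G₂)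
    (hranint : ∀ v : Z, v ∈ Set.range (fun w : D => (Complex.I * ω) • (w : Z) - G w) →
      v ∈ Set.range G₂ → v = 0)
    (hker : ∀ z : D, z ∈ genKer G ω (n - 1) →
      (z : Z) ∈ Set.range (fun w : D => (Complex.I * ω) • (w : Z) - G w))
    (z : ℕ → D) (y : ℕ → Y)
    (h1 : (Complex.I * ω) • ((z 0 : Z)) - G (z 0) = G₂ (y 0))
    (hl : ∀ l : ℕ, 1 ≤ l → l < n →
      (Complex.I * ω) • ((z l : Z)) - G (z l) + ((z (l - 1) : Z)) = G₂ (y l)) :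
    (∀ l : ℕ, l < n → y l = 0) ∧
    ((Complex.I * ω) • ((z 0 : Z)) - G (z 0) = 0 ∧
      ∀ l : ℕ, 1 ≤ l → l < n →
        (Complex.I * ω) • ((z l : Z)) - G (z l) + ((z (l - 1) : Z)) = 0) := by
  have hG : ∀ l : ℕ, l < n → G₂ (y l) = 0 ∧ z l ∈ genKer G ω (l + 1) := by
    intro l
    induction l with
    | zero =>
      intro _
      have h0 : G₂ (y 0) = 0 := hranint _ ⟨z 0, h1⟩ ⟨y 0, rfl⟩
      refine ⟨h0, 0, rfl, ?_⟩
      rw [h1, h0]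
      simp
    | succ l ih =>
      intro hlt
      obtain ⟨_, hz⟩ := ih (by omega)
      have hz' : z l ∈ genKer G ω (n - 1) := genKer_mono G ω (by omega) hz
      obtain ⟨w, hw⟩ := hker _ hz'
      have he := hl (l + 1) (by omega) hlt
      simp only [Nat.add_sub_cancel] at he hw
      have h0 : G₂ (y (l + 1)) = 0 := by
        refine hranint _ ⟨z (l + 1) + w, ?_⟩ ⟨_, rfl⟩
        rw [← he, ← hw]
        simp only [Submodule.coe_add, map_add, smul_add]
        abel
      refine ⟨h0, -z l, genKer_neg G ω _ _ hz, ?_⟩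
      rw [h0] at he
      rw [Submodule.coe_neg]
      exact eq_neg_of_add_eq_zero_left he
  refine ⟨fun l h => hG₂ (by rw [(hG l h).1, map_zero]), ?_, fun l h h' => ?_⟩
  · rw [h1, (hG 0 (by omega)).1]
  · rw [hl l h h', (hG l h').1]
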